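/- Let N ≥ 1 and let p, q ∈ Δ_N with p having all entries strictly positive. Then the Shannon entropy H(q) = -Σ_i q_i log q_i satisfies H(q) ≤ H(p) - Σ_i (1 + log p_i)(q_i - p_i) - (1/2) (Σ_i |p_i - q_i|)²; that is, the entropy is 1-strongly concave on the simplex with respect to the ℓ_1 norm (a consequence of Pinsker's inequality, since the bracketed deficit equals KL(q ‖ p)). -/

import Mathlib

lemma hasDerivAt_log_add_inv {t : ℝ} (ht : 0 < t) :
    HasDerivAt (fun x : ℝ => Real.log x + (1 / 4) * x⁻¹ + (27 / 4) * (x + 2)⁻¹)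
      ((t - 1) ^ 3 / (t ^ 2 * (t + 2) ^ 2)) t := by
  have h2 : t + 2 ≠ 0 := by positivity
  refine (((Real.hasDerivAt_log ht.ne').add ((hasDerivAt_inv ht.ne').const_mul (1 / 4))).add
    ((((hasDerivAt_id t).add_const 2).fun_inv h2).const_mul (27 / 4))).congr_deriv ?_
  simp only [id]
  field_simp
  ring

lemma le_log_add_inv {t : ℝ} (ht : 0 < t) :
    5 / 2 ≤ Real.log t + (1 / 4) * t⁻¹ + (27 / 4) * (t + 2)⁻¹ := by
  set f := fun x : ℝ => Real.log x + (1 / 4) * x⁻¹ + (27 / 4) * (x + 2)⁻¹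
  have hf1 : f 1 = 5 / 2 := by norm_num [f]
  rw [← hf1]
  change f 1 ≤ f t
  rcases le_total t 1 with h | h
  · have hanti : AntitoneOn f (Set.Icc t 1) := by
      refine antitoneOn_of_hasDerivWithinAt_nonpos (convex_Icc t 1)
        (fun x hx => (hasDerivAt_log_add_inv (ht.trans_le hx.1)).continuousAt.continuousWithinAt)
        (fun x hx => (hasDerivAt_log_add_inv
          (ht.trans_le (interior_subset hx).1)).hasDerivWithinAt) fun x hx => ?_
      have hx1 := (interior_subset hx).2
      exact div_nonpos_of_nonpos_of_nonneg
        (Odd.pow_nonpos (by decide) (by linarith)) (by positivity)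
    exact hanti ⟨le_rfl, h⟩ ⟨h, le_rfl⟩ h
  · have hmono : MonotoneOn f (Set.Icc 1 t) := by
      refine monotoneOn_of_hasDerivWithinAt_nonneg (convex_Icc 1 t)
        (fun x hx => (hasDerivAt_log_add_inv
          (one_pos.trans_le hx.1)).continuousAt.continuousWithinAt)
        (fun x hx => (hasDerivAt_log_add_inv
          (one_pos.trans_le (interior_subset hx).1)).hasDerivWithinAt) fun x hx => ?_
      have hx1 := (interior_subset hx).1
      exact div_nonneg (pow_nonneg (by linarith) 3) (by positivity)
    exact hmono ⟨le_rfl, h⟩ ⟨h, le_rfl⟩ h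

/-- Pointwise form of Pinsker's inequality. -/
lemma sq_sub_div_le_mul_log {p q : ℝ} (hp : 0 < p) (hq : 0 ≤ q) :
    3 / 2 * (|p - q| ^ 2 / (q + 2 * p)) ≤
      q * Real.log q - q * Real.log p - q + p := by
  rw [sq_abs]
  rcases hq.eq_or_lt with rfl | hq
  · have h : 3 / 2 * ((p - 0) ^ 2 / (0 + 2 * p)) = 3 / 4 * p := by
      field_simp
      ring
    rw [h]
    linarith
  · have h := mul_le_mul_of_nonneg_left (le_log_add_inv (div_pos hq hp)) hq.le
    rw [Real.log_div hq.ne' hp.ne'] at h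
    have e : 3 / 2 * ((p - q) ^ 2 / (q + 2 * p)) =
        q * (5 / 2) - q * ((1 / 4) * (q / p)⁻¹ + (27 / 4) * (q / p + 2)⁻¹) - q + p := by
      have h2 : q / p + 2 = (q + 2 * p) / p := by field_simp
      rw [h2]
      field_simp
      ring
    rw [e]
    linarith

/-- **Strong concavity of Shannon entropy on the simplex w.r.t. the ℓ₁ norm.** For
`p, q ∈ Δ_N` with `p` strictly positive, the entropy `H(q) = -∑ᵢ qᵢ log qᵢ` satisfies the
quadratic upper bound `H(q) ≤ H(p) - ∑ᵢ (1 + log pᵢ)(qᵢ - pᵢ) - (1/2)(∑ᵢ |pᵢ - qᵢ|)²`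
(a consequence of Pinsker's inequality, since the deficit equals `KL(q ‖ p)`). The
convention `0 log 0 = 0` holds since `Real.log 0 = 0`. -/
theorem entropy_strongly_concave
    (N : ℕ) (hN : 1 ≤ N) (p q : Fin N → ℝ)
    (hppos : ∀ i, 0 < p i) (hpsum : ∑ i, p i = 1)
    (hqpos : ∀ i, 0 ≤ q i) (hqsum : ∑ i, q i = 1) :
    -(∑ i, q i * Real.log (q i))
      ≤ -(∑ i, p i * Real.log (p i))
        - (∑ i, (1 + Real.log (p i)) * (q i - p i))
        - (1 / 2) * (∑ i, |p i - q i|) ^ 2 := by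
  have hcs := Finset.sq_sum_div_le_sum_sq_div Finset.univ (fun i => |p i - q i|)
    (g := fun i => q i + 2 * p i) fun i _ => by linarith [hppos i, hqpos i]
  have hpt := Finset.sum_le_sum fun i (_ : i ∈ Finset.univ) =>
    sq_sub_div_le_mul_log (hppos i) (hqpos i)
  rw [← Finset.mul_sum] at hpt
  have hsum : ∑ i, (q i + 2 * p i) = 3 := by
    rw [Finset.sum_add_distrib, ← Finset.mul_sum, hpsum, hqsum]
    norm_num
  have hdef : ∑ i, (q i * Real.log (q i) - q i * Real.log (p i) - q i + p i) =
      ∑ i, q i * Real.log (q i) - ∑ i, p i * Real.log (p i)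
        - ∑ i, (1 + Real.log (p i)) * (q i - p i) := by
    rw [← Finset.sum_sub_distrib, ← Finset.sum_sub_distrib]
    exact Finset.sum_congr rfl fun i _ => by ring
  rw [hsum] at hcs
  rw [hdef] at hpt
  linarith
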